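/- Let m ∈ ℂ, let (s_n(·;m))_{n≥−1} be an Umemura polynomial sequence with parameter m and (s_n(·;m−1))_{n≥−1} an Umemura polynomial sequence with parameter m − 1. For each integer n ≥ 0 define the rational function u_n(x) := s_n(x; m−1)·s_{n−1}(x; m) / (s_n(x; m)·s_{n−1}(x; m−1)). Then u_n is a rational solution of the generic Painlevé-III equation with parameters Θ₀ = n + m and Θ∞ = m − n + 1, and u_n(x) → 1 as |x| → ∞. -/

import Mathlib

open Complex Polynomial Filter

/-- The generic Painlevé-III equation with parameters `(Θ0, Θinf)` holds for the
function `u` at the point `x`. -/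
def PIIIat (Θ0 Θinf : ℂ) (u : ℂ → ℂ) (x : ℂ) : Prop :=
  deriv (deriv u) x =
    (deriv u x) ^ 2 / u x - deriv u x / x
      + (4 * Θ0 * (u x) ^ 2 + 4 * (1 - Θinf)) / x
      + 4 * (u x) ^ 3 - 4 / u x

/-- The rational function `p/q` is a rational solution of the generic Painlevé-III
equation with parameters `(Θ0, Θinf)`. -/
def IsRatSolutionPIII (Θ0 Θinf : ℂ) (p q : Polynomial ℂ) : Prop :=
  p ≠ 0 ∧ q ≠ 0 ∧ ∀ x : ℂ, x ≠ 0 → p.eval x ≠ 0 → q.eval x ≠ 0 →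
    PIIIat Θ0 Θinf (fun y => p.eval y / q.eval y) x

/-- `s` (indexed over `ℤ`, relevant indices `n ≥ -1`) is an Umemura polynomial
sequence with parameter `m`. -/
def IsUmemuraSeq (m : ℂ) (s : ℤ → Polynomial ℂ) : Prop :=
  (∀ n : ℤ, -1 ≤ n → s n ≠ 0) ∧ s (-1) = 1 ∧ s 0 = 1 ∧
  ∀ n : ℤ, 0 ≤ n →
    2 * s (n - 1) * s (n + 1) =
      (4 * Polynomial.X + Polynomial.C (2 * m + 1)) * (s n) ^ 2
        - s n * Polynomial.derivative (s n)
        - Polynomial.X *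
            (s n * Polynomial.derivative (Polynomial.derivative (s n))
              - (Polynomial.derivative (s n)) ^ 2)

namespace Derivation

variable {F K : Type*} [Field F] [Field K] [Algebra F K]

/-- The Euler logarithmic derivative `x f' / f`. -/
def eulerLog (D : Derivation F K K) (x f : K) : K := x * D f / f

/-- The quantity `2 sₙ₋₁ sₙ₊₁ / sₙ²` prescribed by the Umemura recurrence for `f = sₙ`. -/
def todaRatio (D : Derivation F K K) (x μ f : K) : K := 4 * x + 2 * μ + 1 - D (D.eulerLog x f)

variable (D : Derivation F K K) (x : K)

lemma eulerLog_mul {f g : K} (hf : f ≠ 0) (hg : g ≠ 0) :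
    D.eulerLog x (f * g) = D.eulerLog x f + D.eulerLog x g := by
  simp only [eulerLog, leibniz, smul_eq_mul]
  field_simp
  ring

lemma eulerLog_div {f g : K} (hf : f ≠ 0) (hg : g ≠ 0) :
    D.eulerLog x (f / g) = D.eulerLog x f - D.eulerLog x g := by
  have h := D.eulerLog_mul x (div_ne_zero hf hg) hg
  rw [div_mul_cancel₀ f hg] at h
  linear_combination -h

lemma map_two : D 2 = 0 := by exact_mod_cast D.map_natCast 2

lemma eulerLog_two : D.eulerLog x 2 = 0 := by simp [eulerLog, map_two]

variable {D x}

lemma apply_of_eulerLog {f g : K} (hx : x ≠ 0) (hf : f ≠ 0) (h : D.eulerLog x f = g) :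
    D f = f * g / x := by
  rw [← h, eulerLog]
  field_simp

lemma map_two_mul_mul (hD : D x = 1) (f : K) : D (2 * x * f) = 2 * f + 2 * x * D f := by
  simp only [leibniz, smul_eq_mul, map_two, hD]
  ring

/-- The relations between consecutive members `b, a` and `d, c` of two Umemura sequences with
parameters `μ` and `μ - 1` from which Painlevé-III for `c b / (a d)` follows. -/
structure UmemuraRelations (D : Derivation F K K) (x μ ν b a d c u w v : K) : Prop where
  b_ne : b ≠ 0
  a_ne : a ≠ 0
  d_ne : d ≠ 0
  c_ne : c ≠ 0
  u_eq : u = c * b / (a * d)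
  w_eq : w = 2 * x + D.eulerLog x c - D.eulerLog x a
  v_eq : v = 2 * x + D.eulerLog x d - D.eulerLog x b
  toda_a : D.todaRatio x μ a = (2 * w + 2 * μ + 2 * ν + 1) * u
  toda_c : D.todaRatio x (μ - 1) c = (2 * w + 2 * μ - 2 * ν - 1) / u
  toda_b : D.todaRatio x μ b = (2 * v + 2 * μ - 2 * ν + 1) / u
  add_eq : w + v = 2 * x * (u + 1 / u)

namespace UmemuraRelations

variable {μ ν b a d c u w v : K}

lemma u_ne (h : UmemuraRelations D x μ ν b a d c u w v) : u ≠ 0 := by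
  rw [h.u_eq]
  exact div_ne_zero (mul_ne_zero h.c_ne h.b_ne) (mul_ne_zero h.a_ne h.d_ne)

lemma eulerLog_u (h : UmemuraRelations D x μ ν b a d c u w v) : D.eulerLog x u = w - v := by
  rw [h.u_eq, eulerLog_div, eulerLog_mul, eulerLog_mul, h.w_eq, h.v_eq]
  · ring
  all_goals simp [h.a_ne, h.b_ne, h.c_ne, h.d_ne]

lemma map_w (hD : D x = 1) (h : UmemuraRelations D x μ ν b a d c u w v) :
    D w = (2 * w + 2 * μ + 2 * ν + 1) * u - (2 * w + 2 * μ - 2 * ν - 1) / u := by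
  have h2 := map_two_mul_mul hD (1 : K)
  rw [← h.toda_a, ← h.toda_c, todaRatio, todaRatio, h.w_eq, map_sub, map_add]
  simp only [mul_one, map_one_eq_zero] at h2
  rw [h2]
  ring

/-- The function `c b / (a d)` solves Painlevé-III. -/
lemma painleve (hx : x ≠ 0) (hD : D x = 1) (h : UmemuraRelations D x μ ν b a d c u w v) :
    D (D u) = (D u) ^ 2 / u - D u / x + (4 * (ν + μ) * u ^ 2 + 4 * (ν - μ)) / x
      + 4 * u ^ 3 - 4 / u := by
  have hu := h.u_ne
  have hv : v = 2 * x * (u + 1 / u) - w := by linear_combination h.add_eq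
  have hDu : D u = u * (2 * w - 2 * x * (u + 1 / u)) / x := by
    rw [apply_of_eulerLog hx hu h.eulerLog_u, hv]
    ring
  have hDDu := congrArg D hDu
  simp only [leibniz_div, leibniz, map_sub, map_add, smul_eq_mul, hD, map_two, h.map_w hD,
    map_one_eq_zero] at hDDu
  rw [hDDu, hDu]
  field_simp
  ring

variable {a' c' : K}

/-- The relations propagate along the Umemura recurrence. -/
lemma succ [CharZero K] (hx : x ≠ 0) (hD : D x = 1) (hμ : D μ = 0) (hν : D ν = 0)
    (h : UmemuraRelations D x μ ν b a d c u w v) (ha' : a' ≠ 0) (hc' : c' ≠ 0)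
    (hra : 2 * b * a' = D.todaRatio x μ a * a ^ 2)
    (hrc : 2 * d * c' = D.todaRatio x (μ - 1) c * c ^ 2) :
    UmemuraRelations D x μ (ν + 1) a a' c c' (c' * a / (a' * c))
      (2 * x + D.eulerLog x c' - D.eulerLog x a') w := by
  have hb := h.b_ne
  have ha := h.a_ne
  have hd := h.d_ne
  have hc := h.c_ne
  have hu := h.u_ne
  have hta : D.todaRatio x μ a ≠ 0 := by
    intro h0
    simp [h0, hb, ha'] at hra
  have htc : D.todaRatio x (μ - 1) c ≠ 0 := by
    intro h0
    simp [h0, hd, hc'] at hrc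
  have hDw := h.map_w hD
  have hDu := apply_of_eulerLog hx hu h.eulerLog_u
  have hv : v = 2 * x * (u + 1 / u) - w := by linear_combination h.add_eq
  obtain ⟨p, hp⟩ : ∃ p, p = 2 * w + 2 * μ + 2 * ν + 1 := ⟨_, rfl⟩
  obtain ⟨q, hq⟩ : ∃ q, q = 2 * w + 2 * μ - 2 * ν - 1 := ⟨_, rfl⟩
  have hDp : D p = 2 * D w := by simp [hp, leibniz, map_two, hμ, hν]
  have hDq : D q = 2 * D w := by simp [hq, leibniz, map_two, hμ, hν]
  rw [← hp, ← hq] at hDw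
  have hTa := h.toda_a
  have hTc := h.toda_c
  rw [← hp] at hTa
  rw [← hq] at hTc
  have hp0 : p ≠ 0 := by
    rintro rfl
    simp [hTa] at hta
  have hq0 : q ≠ 0 := by
    rintro rfl
    simp [hTc] at htc
  obtain ⟨y, hy⟩ : ∃ y, y = c' * a / (a' * c) := ⟨_, rfl⟩
  have hy0 : y ≠ 0 := by
    rw [hy]
    exact div_ne_zero (mul_ne_zero hc' ha) (mul_ne_zero ha' hc)
  have hyq : q = p * u * y := by
    have h₁ : q = D.todaRatio x (μ - 1) c * u := by
      rw [hTc]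
      field_simp
    have hTc' : D.todaRatio x (μ - 1) c = 2 * d * c' / c ^ 2 := by
      rw [hrc]
      field_simp
    have hTa' : D.todaRatio x μ a = 2 * b * a' / a ^ 2 := by
      rw [hra]
      field_simp
    rw [h₁, ← hTa, hTc', hTa', hy, h.u_eq]
    field_simp
  have hlp : D.eulerLog x p = 2 * x * (u - y) := by
    rw [eulerLog, hDp, hDw, hyq]
    field_simp
  have hlq : D.eulerLog x q = 2 * x * (1 / y - 1 / u) := by
    rw [eulerLog, hDq, hDw, hyq]
    field_simp
  have hla : D.eulerLog x a' =
      2 * w - 2 * x * (y + 1 / u) + 2 * D.eulerLog x a - D.eulerLog x b := by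
    have hl := congrArg (D.eulerLog x) hra
    rw [hTa, eulerLog_mul _ _ (by simp [hb]) ha', eulerLog_mul _ _ two_ne_zero hb,
      eulerLog_two, sq, eulerLog_mul _ _ (mul_ne_zero hp0 hu) (mul_ne_zero ha ha),
      eulerLog_mul _ _ hp0 hu, eulerLog_mul _ _ ha ha, hlp, h.eulerLog_u] at hl
    linear_combination hl - h.add_eq
  have hlc : D.eulerLog x c' =
      2 * x * (u + 1 / y) - 2 * w + 2 * D.eulerLog x c - D.eulerLog x d := by
    have hl := congrArg (D.eulerLog x) hrc
    rw [hTc, eulerLog_mul _ _ (by simp [hd]) hc', eulerLog_mul _ _ two_ne_zero hd,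
      eulerLog_two, sq, eulerLog_mul _ _ (div_ne_zero hq0 hu) (mul_ne_zero hc hc),
      eulerLog_div _ _ hq0 hu, eulerLog_mul _ _ hc hc, hlq, h.eulerLog_u] at hl
    linear_combination hl + h.add_eq
  obtain ⟨w', hw'⟩ : ∃ w', w' = 2 * x + D.eulerLog x c' - D.eulerLog x a' := ⟨_, rfl⟩
  have hadd : w' + w = 2 * x * (y + 1 / y) := by
    rw [hw', hla, hlc]
    linear_combination -2 * h.w_eq + h.v_eq - h.add_eq
  have hly : D.eulerLog x y = w' - w := by
    rw [hy, eulerLog_div _ _ (mul_ne_zero hc' ha) (mul_ne_zero ha' hc), eulerLog_mul _ _ hc' ha,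
      eulerLog_mul _ _ ha' hc, hw', h.w_eq]
    ring
  have hDy := apply_of_eulerLog hx hy0 hly
  have hw'' : w' = 2 * x * (y + 1 / y) - w := by linear_combination hadd
  have hta' : D.todaRatio x μ a' = (2 * w' + 2 * μ + 2 * (ν + 1) + 1) * y := by
    have hb' : D (D.eulerLog x b) = 4 * x + 2 * μ + 1 - (2 * v + 2 * μ - 2 * ν + 1) / u := by
      rw [← h.toda_b, todaRatio]
      ring
    have ha'' : D (D.eulerLog x a) = 4 * x + 2 * μ + 1 - p * u := by
      rw [← hTa, todaRatio]
      ring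
    have hu' : D (1 / u) = -D u / u ^ 2 := by
      rw [leibniz_div, map_one_eq_zero]
      simp
      field_simp
    rw [todaRatio, hla, map_sub, map_add, map_sub, map_two_mul_mul hD, map_add, hu', hb', leibniz,
      map_two, leibniz, map_two, ha'', hDw, hDy, hDu, hyq, hw'', hv]
    simp only [smul_eq_mul]
    field_simp
    subst hp hq
    linear_combination -u * hyq
  have hDw' : D w' = 2 * (y + 1 / y) + 2 * x * (D y + -D y / y ^ 2) - D w := by
    have hy' : D (1 / y) = -D y / y ^ 2 := by
      rw [leibniz_div, map_one_eq_zero]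
      simp
      field_simp
    rw [hw'', map_sub, map_two_mul_mul hD, map_add, hy']
  have htc' : D.todaRatio x (μ - 1) c' = (2 * w' + 2 * μ - 2 * (ν + 1) - 1) / y := by
    have h₁ : D w' = D.todaRatio x μ a' - D.todaRatio x (μ - 1) c' := by
      have h₁ := map_two_mul_mul hD (1 : K)
      simp only [mul_one, map_one_eq_zero] at h₁
      rw [todaRatio, todaRatio, hw', map_sub, map_add, h₁]
      ring
    have h₂ : D.todaRatio x (μ - 1) c' = D.todaRatio x μ a' - D w' := by
      linear_combination h₁
    rw [h₂, hta', hDw', hDw, hDy, hyq, hw'']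
    subst hp hq
    field_simp
    linear_combination -y * hyq
  rw [← hy, ← hw']
  refine ⟨ha, ha', hc, hc', hy, hw', h.w_eq, hta', htc', ?_, hadd⟩
  rw [hTa, eq_div_iff hy0, ← hyq, hq]
  ring

/-- The relations hold at the start of the two sequences. -/
lemma initial : UmemuraRelations D x μ 0 1 1 1 1 1 (2 * x) (2 * x) := by
  have h : D.todaRatio x μ 1 = 4 * x + 2 * μ + 1 := by simp [todaRatio, eulerLog]
  have h' : D.todaRatio x (μ - 1) 1 = 4 * x + 2 * μ - 1 := by
    simp only [todaRatio, eulerLog, map_one_eq_zero, mul_zero, zero_div, map_zero]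
    ring
  refine ⟨one_ne_zero, one_ne_zero, one_ne_zero, one_ne_zero, ?_, ?_, ?_, ?_, ?_, ?_, ?_⟩
  all_goals first | (simp [eulerLog]; done) | (simp only [h, h']; ring) | ring

end UmemuraRelations

lemma todaRatio_mul_sq (hD : D x = 1) (μ : K) {f : K} (hf : f ≠ 0) :
    D.todaRatio x μ f * f ^ 2 =
      (4 * x + (2 * μ + 1)) * f ^ 2 - f * D f - x * (f * D (D f) - (D f) ^ 2) := by
  simp only [todaRatio, eulerLog, leibniz_div, leibniz, smul_eq_mul, hD]
  field_simp
  ring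

end Derivation

/-- The derivative of polynomials extends to a derivation of the field of fractions. -/
lemma Polynomial.exists_derivation_fractionRing (F : Type*) [Field F] :
    ∃ D : Derivation F (FractionRing F[X]) (FractionRing F[X]),
      ∀ p : F[X], D (algebraMap _ _ p) = algebraMap _ _ (derivative p) := by
  have : Algebra.FormallyEtale F[X] (FractionRing F[X]) :=
    .of_isLocalization (nonZeroDivisors F[X])
  refine ⟨(((mkDerivation F (1 : FractionRing F[X])).liftKaehlerDifferential.liftBaseChange
    (FractionRing F[X])).comp (KaehlerDifferential.tensorKaehlerEquivOfFormallyEtale F F[X]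
      (FractionRing F[X])).symm.toLinearMap).compDer (KaehlerDifferential.D F _), fun p => ?_⟩
  trans ((mkDerivation F (1 : FractionRing F[X])).liftKaehlerDifferential.liftBaseChange
    (FractionRing F[X])) ((KaehlerDifferential.tensorKaehlerEquivOfFormallyEtale F F[X]
      (FractionRing F[X])).symm (KaehlerDifferential.D F _ (algebraMap _ _ p)))
  · rfl
  · rw [KaehlerDifferential.tensorKaehlerEquivOfFormallyEtale_symm_D_algebraMap]
    simp [mkDerivation_apply, Algebra.smul_def]

section Umemura

variable {m : ℂ} {s s' : ℤ → ℂ[X]}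

lemma IsUmemuraSeq.two_mul_mul_eq_todaRatio
    {D : Derivation ℂ (FractionRing ℂ[X]) (FractionRing ℂ[X])}
    (hD : ∀ p : ℂ[X], D (algebraMap _ _ p) = algebraMap _ _ (derivative p))
    (hs : IsUmemuraSeq m s) {n : ℤ} (hn : 0 ≤ n) :
    2 * algebraMap ℂ[X] (FractionRing ℂ[X]) (s (n - 1)) * algebraMap _ _ (s (n + 1)) =
      D.todaRatio (algebraMap ℂ[X] _ X) (algebraMap ℂ[X] _ (C m)) (algebraMap _ _ (s n)) *
        (algebraMap _ _ (s n)) ^ 2 := by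
  have h := congrArg (algebraMap ℂ[X] (FractionRing ℂ[X])) (hs.2.2.2 n hn)
  refine Eq.trans ?_ (Derivation.todaRatio_mul_sq (by simp [hD]) _
    (by simpa using hs.1 n (by lia))).symm
  simp only [map_sub, map_mul, map_add, map_pow, map_ofNat, map_one] at h
  rw [hD, hD]
  exact h

lemma IsUmemuraSeq.exists_umemuraRelations
    {D : Derivation ℂ (FractionRing ℂ[X]) (FractionRing ℂ[X])}
    (hD : ∀ p : ℂ[X], D (algebraMap _ _ p) = algebraMap _ _ (derivative p))
    (hs : IsUmemuraSeq m s) (hs' : IsUmemuraSeq (m - 1) s') (n : ℕ) :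
    ∃ u w v, D.UmemuraRelations (algebraMap ℂ[X] _ X) (algebraMap ℂ[X] _ (C m)) n
      (algebraMap _ _ (s (n - 1))) (algebraMap _ _ (s n))
      (algebraMap _ _ (s' (n - 1))) (algebraMap _ _ (s' n)) u w v := by
  induction n with
  | zero =>
    refine ⟨1, 2 * algebraMap ℂ[X] _ X, 2 * algebraMap ℂ[X] _ X, ?_⟩
    simpa [hs.2.1, hs.2.2.1, hs'.2.1, hs'.2.2.1] using
      Derivation.UmemuraRelations.initial (D := D)
        (x := algebraMap ℂ[X] (FractionRing ℂ[X]) X) (μ := algebraMap ℂ[X] _ (C m))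
  | succ n ih =>
    obtain ⟨u, w, v, h⟩ := ih
    have hra := hs.two_mul_mul_eq_todaRatio hD n.cast_nonneg
    have hrc := hs'.two_mul_mul_eq_todaRatio hD n.cast_nonneg
    rw [C_sub, map_sub, C_1, map_one] at hrc
    have key := h.succ (by simp) (by simp [hD]) (by simp [hD]) (by simp)
      (by simpa using hs.1 (n + 1) (by lia)) (by simpa using hs'.1 (n + 1) (by lia)) hra hrc
    simp only [Nat.cast_add, Nat.cast_one, add_sub_cancel_right]
    exact ⟨_, _, _, key⟩

/-- Painlevé-III for `p / q` in the field of rational functions, cleared of denominators. -/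
lemma Polynomial.painleve_cleared {D : Derivation ℂ (FractionRing ℂ[X]) (FractionRing ℂ[X])}
    (hD : ∀ p : ℂ[X], D (algebraMap _ _ p) = algebraMap _ _ (derivative p))
    {A B : ℂ} {p q : ℂ[X]} (hp : p ≠ 0) (hq : q ≠ 0) {u : FractionRing ℂ[X]}
    (hu : u = algebraMap _ _ p / algebraMap _ _ q)
    (h : D (D u) = (D u) ^ 2 / u - D u / algebraMap ℂ[X] _ X
      + (4 * algebraMap ℂ[X] _ (C A) * u ^ 2 + 4 * algebraMap ℂ[X] _ (C B)) / algebraMap ℂ[X] _ X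
      + 4 * u ^ 3 - 4 / u) :
    X * p * (derivative (derivative p * q - p * derivative q) * q
        - 2 * (derivative p * q - p * derivative q) * derivative q) =
      X * (derivative p * q - p * derivative q) ^ 2
        - (derivative p * q - p * derivative q) * p * q
        + 4 * C A * p ^ 3 * q + 4 * C B * p * q ^ 3 + 4 * X * p ^ 4 - 4 * X * q ^ 4 := by
  have hp' : algebraMap ℂ[X] (FractionRing ℂ[X]) p ≠ 0 := by simpa using hp
  have hq' : algebraMap ℂ[X] (FractionRing ℂ[X]) q ≠ 0 := by simpa using hq
  have hX : algebraMap ℂ[X] (FractionRing ℂ[X]) X ≠ 0 := by simp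
  obtain ⟨r, hr⟩ : ∃ r, r = derivative p * q - p * derivative q := ⟨_, rfl⟩
  rw [← hr]
  have hDu : D u = algebraMap _ _ r / (algebraMap _ _ q * algebraMap _ _ q) := by
    rw [hu, hr, Derivation.leibniz_div, hD, hD]
    simp only [map_sub, map_mul, smul_eq_mul]
    field_simp
  rw [hDu, Derivation.leibniz_div, Derivation.leibniz, hD, hD, hu] at h
  apply IsFractionRing.injective ℂ[X] (FractionRing ℂ[X])
  simp only [map_sub, map_mul, map_add, map_pow, map_ofNat]
  simp only [smul_eq_mul] at h
  field_simp at h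
  linear_combination h

lemma Polynomial.hasDerivAt_eval_div (p q : ℂ[X]) {x : ℂ} (hq : q.eval x ≠ 0) :
    HasDerivAt (fun y => p.eval y / q.eval y)
      ((derivative p * q - p * derivative q).eval x / (q * q).eval x) x := by
  convert! (p.hasDerivAt x).div (q.hasDerivAt x) hq using 1
  simp [sq]

lemma Polynomial.PIIIat_of_painleve_cleared {Θ0 Θinf : ℂ} {p q : ℂ[X]}
    (h : X * p * (derivative (derivative p * q - p * derivative q) * q
        - 2 * (derivative p * q - p * derivative q) * derivative q) =
      X * (derivative p * q - p * derivative q) ^ 2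
        - (derivative p * q - p * derivative q) * p * q
        + 4 * C Θ0 * p ^ 3 * q + 4 * C (1 - Θinf) * p * q ^ 3 + 4 * X * p ^ 4 - 4 * X * q ^ 4)
    {x : ℂ} (hx : x ≠ 0) (hp : p.eval x ≠ 0) (hq : q.eval x ≠ 0) :
    PIIIat Θ0 Θinf (fun y => p.eval y / q.eval y) x := by
  obtain ⟨r, hr⟩ : ∃ r, r = derivative p * q - p * derivative q := ⟨_, rfl⟩
  have h₁ : deriv (fun y => p.eval y / q.eval y) =ᶠ[nhds x]
      fun y => r.eval y / (q * q).eval y := by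
    filter_upwards [q.continuous.continuousAt.eventually_ne hq] with y hy
    rw [(hasDerivAt_eval_div p q hy).deriv, hr]
  have h₂ := (hasDerivAt_eval_div r (q * q) (x := x) (by simpa using hq)).deriv
  rw [PIIIat, h₁.deriv_eq, h₂, h₁.eq_of_nhds]
  rw [← hr] at h
  have h₃ := congrArg (eval x) h
  simp only [eval_mul, eval_add, eval_sub, eval_pow, eval_X, eval_C, eval_ofNat, derivative_mul]
    at h₃ ⊢
  field_simp
  linear_combination h₃

lemma Polynomial.natDegree_X_mul_derivative_le (f : ℂ[X]) :
    (X * derivative f).natDegree ≤ f.natDegree := by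
  rcases Nat.eq_zero_or_pos f.natDegree with h | h
  · simp [derivative_of_natDegree_zero h]
  · have h₁ := natDegree_mul_le (p := (X : ℂ[X])) (q := derivative f)
    have h₂ := natDegree_derivative_le f
    rw [natDegree_X] at h₁
    lia

/-- The right-hand side of the Umemura recurrence has leading term that of `4 X f ^ 2`. -/
lemma Polynomial.natDegree_leadingCoeff_umemura (μ : ℂ) {f : ℂ[X]} (hf : f ≠ 0) :
    ((4 * X + C (2 * μ + 1)) * f ^ 2 - f * derivative f
      - X * (f * derivative (derivative f) - derivative f ^ 2)).natDegree = 2 * f.natDegree + 1 ∧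
    ((4 * X + C (2 * μ + 1)) * f ^ 2 - f * derivative f
      - X * (f * derivative (derivative f) - derivative f ^ 2)).leadingCoeff =
        4 * f.leadingCoeff ^ 2 := by
  have hd : (derivative f).natDegree ≤ f.natDegree :=
    (natDegree_derivative_le f).trans (Nat.sub_le _ _)
  obtain ⟨g, hg⟩ : ∃ g, g = C (2 * μ + 1) * f ^ 2 - f * derivative f
      - (f * (X * derivative (derivative f)) - X * derivative f * derivative f) := ⟨_, rfl⟩
  have hlow : g.natDegree ≤ 2 * f.natDegree := by
    rw [hg]
    refine (natDegree_sub_le _ _).trans (max_le ((natDegree_sub_le _ _).trans (max_le ?_ ?_))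
      ((natDegree_sub_le _ _).trans (max_le ?_ ?_)))
    · exact (natDegree_C_mul_le _ _).trans natDegree_pow_le
    · exact natDegree_mul_le.trans (by lia)
    · have := natDegree_X_mul_derivative_le (derivative f)
      exact natDegree_mul_le.trans (by lia)
    · have := natDegree_X_mul_derivative_le f
      exact natDegree_mul_le.trans (by lia)
  have hdeg : (4 * X * f ^ 2).natDegree = 2 * f.natDegree + 1 := by
    rw [natDegree_mul (by simp) (by simpa using hf), natDegree_mul (by simp) (by simp),
      natDegree_pow, natDegree_X, natDegree_ofNat]
    ring
  have hlead : (4 * X * f ^ 2).leadingCoeff = 4 * f.leadingCoeff ^ 2 := by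
    have h4 : (4 : ℂ[X]) = C 4 := rfl
    rw [h4, leadingCoeff_mul, leadingCoeff_mul, leadingCoeff_X, leadingCoeff_pow, leadingCoeff_C,
      mul_one]
  have heq : (4 * X + C (2 * μ + 1)) * f ^ 2 - f * derivative f
      - X * (f * derivative (derivative f) - derivative f ^ 2) = 4 * X * f ^ 2 + g := by
    rw [hg]
    ring
  have hlt : g.natDegree < (4 * X * f ^ 2).natDegree := by lia
  rw [heq]
  exact ⟨by rw [natDegree_add_eq_left_of_natDegree_lt hlt, hdeg],
    by rw [leadingCoeff_add_of_degree_lt' (degree_lt_degree hlt), hlead]⟩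

lemma IsUmemuraSeq.natDegree_add {μ : ℂ} (hs : IsUmemuraSeq μ s) {n : ℤ} (hn : 0 ≤ n) :
    (s (n - 1)).natDegree + (s (n + 1)).natDegree = 2 * (s n).natDegree + 1 := by
  rw [← (natDegree_leadingCoeff_umemura μ (hs.1 n (by lia))).1, ← hs.2.2.2 n hn,
    natDegree_mul (mul_ne_zero two_ne_zero (hs.1 _ (by lia))) (hs.1 _ (by lia)),
    natDegree_mul two_ne_zero (hs.1 _ (by lia)), natDegree_ofNat, zero_add]

lemma IsUmemuraSeq.leadingCoeff_mul {μ : ℂ} (hs : IsUmemuraSeq μ s) {n : ℤ} (hn : 0 ≤ n) :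
    2 * (s (n - 1)).leadingCoeff * (s (n + 1)).leadingCoeff = 4 * (s n).leadingCoeff ^ 2 := by
  have h2 : (2 : ℂ[X]) = C 2 := rfl
  rw [← (natDegree_leadingCoeff_umemura μ (hs.1 n (by lia))).2, ← hs.2.2.2 n hn,
    Polynomial.leadingCoeff_mul, Polynomial.leadingCoeff_mul, h2, leadingCoeff_C]

/-- Degrees and leading coefficients of Umemura polynomials do not depend on the parameter. -/
lemma IsUmemuraSeq.natDegree_leadingCoeff_eq {μ μ' : ℂ} (hs : IsUmemuraSeq μ s)
    (hs' : IsUmemuraSeq μ' s') (n : ℕ) :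
    ((s (n - 1)).natDegree = (s' (n - 1)).natDegree ∧
      (s (n - 1)).leadingCoeff = (s' (n - 1)).leadingCoeff) ∧
    ((s n).natDegree = (s' n).natDegree ∧ (s n).leadingCoeff = (s' n).leadingCoeff) := by
  induction n with
  | zero => simp [hs.2.1, hs.2.2.1, hs'.2.1, hs'.2.2.1]
  | succ n ih =>
    obtain ⟨⟨hd, hl⟩, hd', hl'⟩ := ih
    have h₁ := hs.natDegree_add n.cast_nonneg
    have h₁' := hs'.natDegree_add n.cast_nonneg
    have h₂ := hs.leadingCoeff_mul n.cast_nonneg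
    have h₂' := hs'.leadingCoeff_mul n.cast_nonneg
    have h₀ : 2 * (s' (n - 1)).leadingCoeff ≠ 0 := by simpa using hs'.1 (n - 1) (by lia)
    push_cast
    rw [add_sub_cancel_right]
    refine ⟨⟨hd', hl'⟩, by lia, mul_left_cancel₀ h₀ ?_⟩
    rw [h₂', ← hl, h₂, hl']

lemma Polynomial.tendsto_eval_div_cobounded {p q : ℂ[X]} (hq : q ≠ 0)
    (hd : p.natDegree = q.natDegree) (hl : p.leadingCoeff = q.leadingCoeff) :
    Tendsto (fun x : ℂ => p.eval x / q.eval x) (Bornology.cobounded ℂ) (nhds 1) := by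
  have h := isEquivalent_cobounded_leading_monomial (P := p)
  rw [hd, hl] at h
  refine (Asymptotics.isEquivalent_iff_tendsto_one ?_).1
    (h.trans isEquivalent_cobounded_leading_monomial.symm)
  exact (Metric.cobounded_eq_cocompact (α := ℂ) ▸ Filter.cocompact_le_cofinite)
    (eventually_cofinite_not_isRoot hq)

end Umemura

/-- For Umemura sequences `s(·;m)` and `s'(·;m-1)`, for each `n ≥ 0` the rational
function `u_n = s'_n · s_{n-1} / (s_n · s'_{n-1})` is a rational solution of
Painlevé-III with `Θ0 = n + m`, `Θinf = m - n + 1`, and `u_n(x) → 1` as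
`|x| → ∞`. -/
theorem umemura_gives_rational_solutions (m : ℂ)
    (s s' : ℤ → Polynomial ℂ)
    (hs : IsUmemuraSeq m s) (hs' : IsUmemuraSeq (m - 1) s') (n : ℕ) :
    IsRatSolutionPIII ((n : ℂ) + m) (m - (n : ℂ) + 1)
      (s' (n : ℤ) * s ((n : ℤ) - 1)) (s (n : ℤ) * s' ((n : ℤ) - 1)) ∧
    Filter.Tendsto
      (fun x : ℂ =>
        (s' (n : ℤ) * s ((n : ℤ) - 1)).eval x / (s (n : ℤ) * s' ((n : ℤ) - 1)).eval x)
      (Bornology.cobounded ℂ) (nhds 1) := by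
  have hp : s' n * s (n - 1) ≠ 0 := mul_ne_zero (hs'.1 n (by lia)) (hs.1 (n - 1) (by lia))
  have hq : s n * s' (n - 1) ≠ 0 := mul_ne_zero (hs.1 n (by lia)) (hs'.1 (n - 1) (by lia))
  refine ⟨⟨hp, hq, fun x hx hpx hqx => ?_⟩, ?_⟩
  · obtain ⟨D, hD⟩ := exists_derivation_fractionRing ℂ
    obtain ⟨u, w, v, h⟩ := hs.exists_umemuraRelations hD hs' n
    refine PIIIat_of_painleve_cleared (painleve_cleared hD hp hq (u := u) ?_ ?_) hx hpx hqx
    · rw [h.u_eq, map_mul, map_mul]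
    · refine (h.painleve (by simp) (by simp [hD])).trans ?_
      simp only [map_add, map_sub, map_natCast, map_one]
      ring
  · obtain ⟨⟨hd, hl⟩, hd', hl'⟩ := hs.natDegree_leadingCoeff_eq hs' n
    refine tendsto_eval_div_cobounded hq ?_ ?_
    · rw [natDegree_mul (left_ne_zero_of_mul hp) (right_ne_zero_of_mul hp),
        natDegree_mul (left_ne_zero_of_mul hq) (right_ne_zero_of_mul hq), hd, hd']
    · rw [leadingCoeff_mul, leadingCoeff_mul, hl, hl']
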